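/- Let k ≥ 2 and n ≥ 1 be integers. If X is a metric space with dim X = kn, then ∂Δ^k-Ind X = n and ∂Δ^k-str X = 0. -/

import Mathlib

open Set Topology Cardinal

noncomputable section

attribute [local instance] Classical.propDecidable

/-- Values of dimension functions: `⊥ : WithBot Ordinal.{0}` encodes `−1`,
ordinals are the usual values, and `⊤` encodes `∞`. -/
abbrev Dim : Type 1 := WithTop (WithBot Ordinal.{0})

/-- An ordinal viewed as a dimension value. -/
def Dim.ofOrdinal (a : Ordinal.{0}) : Dim := ((a : WithBot Ordinal.{0}) : Dim)

/-- The dimension value `−1`. -/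
def Dim.minusOne : Dim := ((⊥ : WithBot Ordinal.{0}) : Dim)

/-- An integer `m ≥ −1` viewed as a dimension value. -/
def Dim.ofInt (m : ℤ) : Dim := if 0 ≤ m then Dim.ofOrdinal m.toNat else Dim.minusOne

/-- `A` is a `K`-tuple for the simplicial complex `K` on the vertex set `Fin m`:
whenever the members indexed by a nonempty `I` have a common point, `I` spans a
simplex of `K`. -/
def IsKTuple {m : ℕ} (K : Finset (Fin m) → Prop) {X : Type} (A : Fin m → Set X) : Prop :=
  ∀ I : Finset (Fin m), I.Nonempty → (⋂ i ∈ I, A i).Nonempty → K I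

/-- `K` is an abstract (finite) simplicial complex with vertex set `Fin m`:
it is closed under passing to nonempty subsets, and contains every vertex. -/
def IsComplex {m : ℕ} (K : Finset (Fin m) → Prop) : Prop :=
  (∀ s t : Finset (Fin m), s ⊆ t → s.Nonempty → K t → K s) ∧ ∀ i, K {i}

/-- The boundary complex `∂Δ^k` of the `k`-simplex: all proper subsets of the
`k+1` vertices span simplices. -/
def bComplex (k : ℕ) : Finset (Fin (k + 1)) → Prop := fun s => s ≠ Finset.univ

/-- `U` is an (open) `K`-neighbourhood of the tuple `F`. -/
def KNbhd {m : ℕ} (K : Finset (Fin m) → Prop) {X : Type} [TopologicalSpace X]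
    (F U : Fin m → Set X) : Prop :=
  (∀ i, IsOpen (U i)) ∧ IsKTuple K U ∧ ∀ i, F i ⊆ U i

/-- Auxiliary form of `K-Ind X ≤ α`, defined by transfinite recursion on `α`:
every closed `K`-tuple has a `K`-neighbourhood whose corresponding `K`-partition
is either empty (dimension `−1`) or has `K-Ind < α`. -/
def KIndLeAux {m : ℕ} (K : Finset (Fin m) → Prop) :
    Ordinal.{0} → ∀ X : Type, TopologicalSpace X → Prop :=
  (wellFounded_lt (α := Ordinal.{0})).fix fun α rec X tX =>
    letI := tX
    ∀ F : Fin m → Set X, (∀ i, IsClosed (F i)) → IsKTuple K F →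
      ∃ U : Fin m → Set X, (∀ i, IsOpen (U i)) ∧ IsKTuple K U ∧ (∀ i, F i ⊆ U i) ∧
        ((⋃ i, U i)ᶜ = (∅ : Set X) ∨
          ∃ β : Set.Iio α, rec β.1 β.2 (↥((⋃ i, U i)ᶜ)) inferInstance)

/-- `K-Ind X ≤ α` (for an ordinal `α ≥ 0`). -/
def KIndLE {m : ℕ} (K : Finset (Fin m) → Prop) (X : Type) [tX : TopologicalSpace X]
    (α : Ordinal.{0}) : Prop :=
  KIndLeAux K α X tX

/-- Fedorchuk's inductive dimension `K-Ind` modulo a simplicial complex `K`;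
`−1` for the empty space, the least `α` with `K-Ind X ≤ α` otherwise, `∞` if none. -/
def KInd {m : ℕ} (K : Finset (Fin m) → Prop) (X : Type) [TopologicalSpace X] : Dim :=
  if IsEmpty X then Dim.minusOne
  else if ∃ α, KIndLE K X α then Dim.ofOrdinal (sInf {α | KIndLE K X α}) else ⊤

/-- The set of `K`-obstruction points of an open `K`-tuple `U`: points covered
by no `K`-neighbourhood of `U`. -/
def KObs {m : ℕ} (K : Finset (Fin m) → Prop) {X : Type} [TopologicalSpace X]
    (U : Fin m → Set X) : Set X :=
  {x | ¬ ∃ V : Fin m → Set X, KNbhd K U V ∧ x ∈ ⋃ i, V i}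

/-- `X` is strongly `α`-dimensional: `K-Ind X` is a positive ordinal `α` and some
closed `K`-tuple admits no `K`-neighbourhood `U` without obstruction points whose
corresponding `K`-partition has `K-Ind < α`. -/
def KStrongly {m : ℕ} (K : Finset (Fin m) → Prop) (X : Type) [TopologicalSpace X] : Prop :=
  (∃ α : Ordinal.{0}, 0 < α ∧ KInd K X = Dim.ofOrdinal α) ∧
  ∃ F : Fin m → Set X, (∀ i, IsClosed (F i)) ∧ IsKTuple K F ∧
    ∀ U : Fin m → Set X, KNbhd K F U →
      KInd K (↥((⋃ i, U i)ᶜ)) < KInd K X → KObs K U ≠ ∅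

/-- The dimensional strength degree `K-str X ∈ {0,1}`. -/
def KStr {m : ℕ} (K : Finset (Fin m) → Prop) (X : Type) [TopologicalSpace X] : ℕ :=
  if KStrongly K X then 1 else 0

/-- `K-dim X ≤ n`: any `n+1` closed `K`-tuples admit `K`-partitions with empty
intersection. -/
def KDimLE {m : ℕ} (K : Finset (Fin m) → Prop) (X : Type) [TopologicalSpace X] (n : ℕ) : Prop :=
  ∀ F : Fin (n + 1) → Fin m → Set X,
    (∀ j i, IsClosed (F j i)) → (∀ j, IsKTuple K (F j)) →
    ∃ U : Fin (n + 1) → Fin m → Set X, (∀ j, KNbhd K (F j) (U j)) ∧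
      (⋂ j, (⋃ i, U j i)ᶜ) = (∅ : Set X)

/-- Fedorchuk's dimension `K-dim` modulo a simplicial complex `K`. -/
def KDim {m : ℕ} (K : Finset (Fin m) → Prop) (X : Type) [TopologicalSpace X] : Dim :=
  if IsEmpty X then Dim.minusOne
  else if ∃ n, KDimLE K X n then Dim.ofOrdinal ((sInf {n | KDimLE K X n} : ℕ) : Ordinal.{0}) else ⊤

/-- `dim X ≤ n` for the Lebesgue covering dimension: every finite open cover has
an open shrinking of order at most `n+1`. -/
def CovDimLE (X : Type) [TopologicalSpace X] (n : ℕ) : Prop :=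
  ∀ (ι : Type), Finite ι → ∀ U : ι → Set X, (∀ i, IsOpen (U i)) → (⋃ i, U i) = Set.univ →
    ∃ V : ι → Set X, (∀ i, IsOpen (V i)) ∧ (∀ i, V i ⊆ U i) ∧ (⋃ i, V i) = Set.univ ∧
      ∀ x : X, ({i | x ∈ V i}).ncard ≤ n + 1

/-- The Lebesgue covering dimension. -/
def covDim (X : Type) [TopologicalSpace X] : Dim :=
  if IsEmpty X then Dim.minusOne
  else if ∃ n, CovDimLE X n then Dim.ofOrdinal ((sInf {n | CovDimLE X n} : ℕ) : Ordinal.{0}) else ⊤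

/-- `Ind X ≤ n` for the large inductive dimension, by recursion on `n`. -/
def IndLE : ℕ → ∀ X : Type, TopologicalSpace X → Prop
  | 0, X, tX =>
    letI := tX
    ∀ F U : Set X, IsClosed F → IsOpen U → F ⊆ U →
      ∃ V : Set X, IsOpen V ∧ F ⊆ V ∧ V ⊆ U ∧ frontier V = ∅
  | n + 1, X, tX =>
    letI := tX
    ∀ F U : Set X, IsClosed F → IsOpen U → F ⊆ U →
      ∃ V : Set X, IsOpen V ∧ F ⊆ V ∧ V ⊆ U ∧ IndLE n (↥(frontier V)) inferInstance

/-- The large inductive dimension `Ind`. -/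
def IndDim (X : Type) [tX : TopologicalSpace X] : Dim :=
  if IsEmpty X then Dim.minusOne
  else if ∃ n, IndLE n X tX then Dim.ofOrdinal ((sInf {n | IndLE n X tX} : ℕ) : Ordinal.{0}) else ⊤

/-- The relation generating the topological join `A ∗ B`: the copy of `B` is
collapsed at parameter `0`, the copy of `A` at parameter `1`. -/
def JoinRel (A B : Type) : (A × B × unitInterval) → (A × B × unitInterval) → Prop :=
  fun p q => (p.2.2 = 0 ∧ q.2.2 = 0 ∧ p.1 = q.1) ∨ (p.2.2 = 1 ∧ q.2.2 = 1 ∧ p.2.1 = q.2.1)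

/-- The topological join `A ∗ B`. -/
abbrev Join (A B : Type) [TopologicalSpace A] [TopologicalSpace B] : Type :=
  Quot (JoinRel A B)

/-- Auxiliary construction of the join of `n+1` copies of `L`, bundled with its
topology. -/
def JoinPowAux (L : Type) (tL : TopologicalSpace L) : ℕ → (T : Type) × TopologicalSpace T
  | 0 => ⟨L, tL⟩
  | n + 1 =>
    let p := JoinPowAux L tL n
    letI := tL
    letI := p.2
    ⟨Join L p.1, inferInstance⟩

/-- The join `L ∗ ⋯ ∗ L` of `n+1` copies of `L`. -/
def JoinPow (L : Type) [tL : TopologicalSpace L] (n : ℕ) : Type :=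
  (JoinPowAux L tL n).1

instance joinPowTopologicalSpace (L : Type) [tL : TopologicalSpace L] (n : ℕ) :
    TopologicalSpace (JoinPow L n) :=
  (JoinPowAux L tL n).2

/-- `L-dim X ≤ n`: every continuous map from a closed subset of `X` to the join
of `n+1` copies of `L` extends continuously over `X`. -/
def LDimLE (L : Type) [TopologicalSpace L] (X : Type) [TopologicalSpace X] (n : ℕ) : Prop :=
  ∀ F : Set X, IsClosed F → ∀ f : C(F, JoinPow L n),
    ∃ g : C(X, JoinPow L n), ∀ x : F, g x = f x

/-- Fedorchuk's dimension `L-dim` modulo an ANR `L`. -/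
def LDim (L : Type) [TopologicalSpace L] (X : Type) [TopologicalSpace X] : Dim :=
  if IsEmpty X then Dim.minusOne
  else if ∃ n, LDimLE L X n then Dim.ofOrdinal ((sInf {n | LDimLE L X n} : ℕ) : Ordinal.{0}) else ⊤

/-- Auxiliary form of `L-Ind X ≤ α`, by transfinite recursion on `α`: every map
to `L` from a closed subset of `X` has an `L`-partition which is either empty or
has `L-Ind < α`. -/
def LIndLeAux (L : Type) [TopologicalSpace L] :
    Ordinal.{0} → ∀ X : Type, TopologicalSpace X → Prop :=
  (wellFounded_lt (α := Ordinal.{0})).fix fun α rec X tX =>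
    letI := tX
    ∀ F : Set X, IsClosed F → ∀ f : C(F, L),
      ∃ U : Set X, IsOpen U ∧ ∃ hFU : F ⊆ U,
        (∃ g : C(U, L), ∀ (x : X) (hx : x ∈ F), g ⟨x, hFU hx⟩ = f ⟨x, hx⟩) ∧
        (Uᶜ = (∅ : Set X) ∨ ∃ β : Set.Iio α, rec β.1 β.2 (↥(Uᶜ)) inferInstance)

/-- `L-Ind X ≤ α` (for an ordinal `α ≥ 0`). -/
def LIndLE (L : Type) [TopologicalSpace L] (X : Type) [tX : TopologicalSpace X]
    (α : Ordinal.{0}) : Prop :=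
  LIndLeAux L α X tX

/-- Fedorchuk's inductive dimension `L-Ind` modulo an ANR `L`. -/
def LInd (L : Type) [TopologicalSpace L] (X : Type) [TopologicalSpace X] : Dim :=
  if IsEmpty X then Dim.minusOne
  else if ∃ α, LIndLE L X α then Dim.ofOrdinal (sInf {α | LIndLE L X α}) else ⊤

/-- `L` is an absolute neighbourhood retract (for metric spaces): `L` is
metrizable and whenever a closed subset `A` of a metric space is homeomorphic to
`L` via `e`, the map `e` extends continuously over a neighbourhood of `A`. -/
def IsANR (L : Type) [TopologicalSpace L] : Prop :=
  TopologicalSpace.MetrizableSpace L ∧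
  ∀ (M : Type) [MetricSpace M], ∀ A : Set M, IsClosed A → ∀ e : A ≃ₜ L,
    ∃ U : Set M, IsOpen U ∧ ∃ hAU : A ⊆ U, ∃ r : C(U, L),
      ∀ (a : M) (ha : a ∈ A), r ⟨a, hAU ha⟩ = e ⟨a, ha⟩

/-- `L-Ind_{b+} X`: the least dimension value `d` such that some open
neighbourhood of `b` has closure of `L-Ind` at most `d`. -/
def LIndPlus (L : Type) [TopologicalSpace L] {X : Type} [TopologicalSpace X] (b : X) : Dim :=
  sInf {d : Dim | ∃ U : Set X, IsOpen U ∧ b ∈ U ∧ LInd L (↥(closure U)) ≤ d}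

/-- The set `K(X) = {b ∈ X : L-Ind_{b+} X = L-Ind X}`. -/
def LKset (L : Type) [TopologicalSpace L] (X : Type) [TopologicalSpace X] : Set X :=
  {b | LIndPlus L b = LInd L X}

/-- The weight of a topological space: the least cardinality of a basis. -/
def tWeight (X : Type) [TopologicalSpace X] : Cardinal :=
  sInf {c | ∃ B : Set (Set X), TopologicalSpace.IsTopologicalBasis B ∧ #B = c}

/-- The family `𝒮_X` of all subsets of `X` that are finite or homeomorphic to the
one-point compactification `A_{ℵ₀}` of a countably infinite discrete space. -/
def SFam (X : Type) [TopologicalSpace X] : Set (Set X) :=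
  {S | S.Finite ∨ Nonempty (↥S ≃ₜ OnePoint ℕ)}

/-- The relation generating the quotient `N` in the `Z(X,Y)` construction:
each set `{μ} × {x} × Y` is collapsed to a point. -/
def ZRel (ι X Y : Type) : (OnePoint ι × X × Y) → (OnePoint ι × X × Y) → Prop :=
  fun p q => p.1 = OnePoint.infty ∧ q.1 = OnePoint.infty ∧ p.2.1 = q.2.1

/-- The quotient space `N` of `A_𝔪 × X × Y`. -/
abbrev ZQuot (ι X Y : Type) [TopologicalSpace ι] [TopologicalSpace X] [TopologicalSpace Y] :
    Type :=
  Quot (ZRel ι X Y)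

/-- The subset `Z(X,Y) = ⋃_{α ∈ A_𝔪} H(α)` of `N`:  `H(μ) = π₁({μ} × X × Y)` and
`H(α) = π₁({α} × φ(α) × Y)` for `α ≠ μ`. -/
def ZSet (ι X Y : Type) [TopologicalSpace ι] [TopologicalSpace X] [TopologicalSpace Y]
    (φ : ι → Set X) : Set (ZQuot ι X Y) :=
  {z | ∃ p : OnePoint ι × X × Y, Quot.mk (ZRel ι X Y) p = z ∧
        (p.1 = OnePoint.infty ∨ ∃ i : ι, p.1 = (i : OnePoint ι) ∧ p.2.1 ∈ φ i)}

/-- The space `Z(X,Y)` (for the data `ι`, `φ`), with the subspace topology. -/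
abbrev ZSpace (ι X Y : Type) [TopologicalSpace ι] [TopologicalSpace X] [TopologicalSpace Y]
    (φ : ι → Set X) : Type :=
  ↥(ZSet ι X Y φ)

/-- The subset `H(μ)` of `Z(X,Y)`. -/
def ZHmu (ι X Y : Type) [TopologicalSpace ι] [TopologicalSpace X] [TopologicalSpace Y]
    (φ : ι → Set X) : Set (ZSpace ι X Y φ) :=
  {z | ∃ (x : X) (y : Y), (z : ZQuot ι X Y) = Quot.mk (ZRel ι X Y) (OnePoint.infty, x, y)}

/-- The projection `π_X : N → X`, `π₁(α,x,y) ↦ x`. -/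
def ZQuotProjX {ι X Y : Type} [TopologicalSpace ι] [TopologicalSpace X] [TopologicalSpace Y] :
    ZQuot ι X Y → X :=
  Quot.lift (fun p => p.2.1) (fun _ _ h => h.2.2)

/-- The projection `π_X : Z(X,Y) → X`. -/
def ZProjX {ι X Y : Type} [TopologicalSpace ι] [TopologicalSpace X] [TopologicalSpace Y]
    (φ : ι → Set X) : ZSpace ι X Y φ → X :=
  fun z => ZQuotProjX (z : ZQuot ι X Y)

/-- The cardinality requirements on the index set `ι` (of cardinality `𝔪`) in the
`Z(X,Y)` construction: `𝔪 ≥ max {ℵ₀, (wX)⁺, (wY)⁺, card 𝒮_X}`. -/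
def ZCardOK (X Y ι : Type) [TopologicalSpace X] [TopologicalSpace Y] : Prop :=
  ℵ₀ ≤ #ι ∧ tWeight X < #ι ∧ tWeight Y < #ι ∧ #(SFam X) ≤ #ι

/-- The requirements on `φ : A_𝔪 \ {μ} → 𝒮_X`: it takes values in `𝒮_X` and every
fibre has cardinality `𝔪`. -/
def ZPhiOK {X ι : Type} [TopologicalSpace X] (φ : ι → Set X) : Prop :=
  (∀ i, φ i ∈ SFam X) ∧ ∀ S ∈ SFam X, #(↥(φ ⁻¹' {S})) = #ι



/-! ### Shrinking helpers -/

lemma closedShrink {X ι : Type} [TopologicalSpace X] [NormalSpace X] [Finite ι] (W : ι → Set X)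
    (hW : ∀ i, IsOpen (W i)) (hc : (⋃ i, W i) = Set.univ) :
    ∃ D : ι → Set X, (∀ i, IsClosed (D i)) ∧ (∀ i, D i ⊆ W i) ∧ (⋃ i, D i) = Set.univ := by
  obtain ⟨D, h1, h2, h3⟩ := exists_iUnion_eq_closed_subset hW (fun x => Set.toFinite _) hc
  exact ⟨D, h2, h3, h1⟩

lemma isKTuple_bComplex {k : ℕ} {X : Type} (A : Fin (k + 1) → Set X) :
    IsKTuple (bComplex k) A ↔ (⋂ i, A i) = ∅ := by
  constructor
  · intro h
    by_contra hne
    have h2 : (⋂ i ∈ (Finset.univ : Finset (Fin (k + 1))), A i).Nonempty := by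
      simpa using Set.nonempty_iff_ne_empty.2 hne
    exact h Finset.univ Finset.univ_nonempty h2 rfl
  · intro h I _ hI hIu
    subst hIu
    simp only [Finset.mem_univ, iInter_true] at hI
    rw [h] at hI
    exact Set.not_nonempty_empty hI

lemma kIndLE_iff {m : ℕ} (K : Finset (Fin m) → Prop) (X : Type) [TopologicalSpace X]
    (α : Ordinal.{0}) :
    KIndLE K X α ↔ ∀ F : Fin m → Set X, (∀ i, IsClosed (F i)) → IsKTuple K F →
      ∃ U : Fin m → Set X, (∀ i, IsOpen (U i)) ∧ IsKTuple K U ∧ (∀ i, F i ⊆ U i) ∧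
        ((⋃ i, U i)ᶜ = (∅ : Set X) ∨
          ∃ β < α, KIndLE K (↥((⋃ i, U i)ᶜ)) β) := by
  unfold KIndLE KIndLeAux
  rw [WellFounded.fix_eq]
  constructor
  · intro h F hF hK
    obtain ⟨U, h1, h2, h3, h4⟩ := h F hF hK
    refine ⟨U, h1, h2, h3, h4.imp id ?_⟩
    rintro ⟨β, hβ⟩
    exact ⟨β.1, β.2, hβ⟩
  · intro h F hF hK
    obtain ⟨U, h1, h2, h3, h4⟩ := h F hF hK
    refine ⟨U, h1, h2, h3, h4.imp id ?_⟩
    rintro ⟨β, hβ, hh⟩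
    exact ⟨⟨β, hβ⟩, hh⟩

lemma kIndLE_mono {m : ℕ} {K : Finset (Fin m) → Prop} {X : Type} [TopologicalSpace X]
    {α β : Ordinal.{0}} (hab : α ≤ β) (h : KIndLE K X α) : KIndLE K X β := by
  rw [kIndLE_iff] at h ⊢
  intro F hF hK
  obtain ⟨U, h1, h2, h3, h4⟩ := h F hF hK
  refine ⟨U, h1, h2, h3, h4.imp id ?_⟩
  rintro ⟨γ, hγ, hh⟩
  exact ⟨γ, hγ.trans_le hab, hh⟩

/-! ### Avoidable sets -/

/-- `Z` can be avoided by partitions. -/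
def Avoidable {X : Type} [TopologicalSpace X] (Z : Set X) : Prop :=
  ∀ F W : Set X, IsClosed F → IsOpen W → F ⊆ W →
    ∃ N : Set X, IsOpen N ∧ F ⊆ N ∧ closure N ⊆ W ∧ Disjoint (frontier N) Z

/-- `X` is a union of `d` avoidable sets. -/
def DLE (X : Type) [TopologicalSpace X] (d : ℕ) : Prop :=
  ∃ Z : Fin d → Set X, (∀ i, Avoidable (Z i)) ∧ (⋃ i, Z i) = Set.univ

lemma Avoidable.preimage {X : Type} [TopologicalSpace X] {Z : Set X}
    (hZ : Avoidable Z) {Y : Set X} (hY : IsClosed Y) :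
    Avoidable ((↑) ⁻¹' Z : Set Y) := by
  intro F W hF hW hFW
  obtain ⟨W', hW', rfl⟩ := isOpen_induced_iff.1 hW
  have hF' : IsClosed ((↑) '' F : Set X) := hY.isClosedEmbedding_subtypeVal.isClosedMap F hF
  obtain ⟨N, h1, h2, h3, h4⟩ := hZ _ W' hF' hW' (by rintro _ ⟨x, hx, rfl⟩; exact hFW hx)
  have hcl : closure ((↑) ⁻¹' N : Set Y) ⊆ (↑) ⁻¹' closure N :=
    continuous_subtype_val.closure_preimage_subset N
  refine ⟨(↑) ⁻¹' N, h1.preimage continuous_subtype_val, fun x hx => h2 ⟨x, hx, rfl⟩,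
    hcl.trans (preimage_mono h3), ?_⟩
  rw [Set.disjoint_left] at h4 ⊢
  intro x hx hxZ
  refine h4 (a := (x : X)) ?_ hxZ
  rw [h1.frontier_eq]
  rw [(h1.preimage continuous_subtype_val).frontier_eq] at hx
  exact ⟨hcl hx.1, hx.2⟩

lemma DLE.of_closed {X : Type} [TopologicalSpace X] {d : ℕ} (Z : Fin d → Set X)
    (hZ : ∀ i, Avoidable (Z i)) {Y : Set X} (hY : IsClosed Y) (hc : Y ⊆ ⋃ i, Z i) :
    DLE Y d := by
  refine ⟨fun i => (↑) ⁻¹' (Z i), fun i => (hZ i).preimage hY, ?_⟩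
  rw [← preimage_iUnion]
  exact eq_univ_of_forall fun x => hc x.2

/-- Partition of a closed tuple missing `k` avoidable sets. -/
lemma exists_nbhd_avoiding {X : Type} [TopologicalSpace X] [NormalSpace X] {k : ℕ}
    (Z : Fin k → Set X) (hZ : ∀ i, Avoidable (Z i)) (F : Fin (k + 1) → Set X)
    (hF : ∀ i, IsClosed (F i)) (hFe : (⋂ i, F i) = ∅) :
    ∃ U : Fin (k + 1) → Set X, (∀ i, IsOpen (U i)) ∧ (⋂ i, U i) = ∅ ∧ (∀ i, F i ⊆ U i) ∧
      ∀ i, Disjoint ((⋃ i, U i)ᶜ) (Z i) := by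
  obtain ⟨D, hD, hDW, hDc⟩ := closedShrink (fun i => (F i)ᶜ) (fun i => (hF i).isOpen_compl)
    (by rw [← compl_iInter, hFe, compl_empty])
  have := fun i : Fin k => hZ i (D i.succ) ((F i.succ)ᶜ) (hD _) (hF _).isOpen_compl (hDW _)
  choose N hN1 hN2 hN3 hN4 using this
  refine ⟨Fin.cons (⋃ i, N i) (fun i => (closure (N i))ᶜ), ?_, ?_, ?_, ?_⟩
  · intro i
    refine Fin.cases ?_ (fun i => ?_) i
    · simpa using isOpen_iUnion hN1
    · simp
  · rw [eq_empty_iff_forall_notMem]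
    intro x hx
    rw [mem_iInter] at hx
    have h0 := hx 0
    simp only [Fin.cons_zero, mem_iUnion] at h0
    obtain ⟨i, hi⟩ := h0
    have h1 := hx i.succ
    simp only [Fin.cons_succ] at h1
    exact h1 (subset_closure hi)
  · intro i
    refine Fin.cases ?_ (fun i => ?_) i
    · intro x hx
      have hxD : x ∈ ⋃ i, D i := hDc ▸ mem_univ x
      obtain ⟨j, hj⟩ := mem_iUnion.1 hxD
      revert hj
      refine Fin.cases (fun hj => ?_) (fun j hj => ?_) j
      · exact absurd hx (hDW 0 hj)
      · simp only [Fin.cons_zero, mem_iUnion]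
        exact ⟨j, hN2 j hj⟩
    · intro x hx
      simp only [Fin.cons_succ]
      exact fun h => hN3 i h hx
  · intro i
    rw [Set.disjoint_left]
    intro x hx hxZ
    simp only [mem_compl_iff, mem_iUnion, not_exists] at hx
    have h0 := hx 0
    have h1 := hx i.succ
    simp only [Fin.cons_zero, mem_iUnion, not_exists] at h0
    simp only [Fin.cons_succ, mem_compl_iff, not_not] at h1
    refine Set.disjoint_left.1 (hN4 i) ?_ hxZ
    rw [(hN1 i).frontier_eq]
    exact ⟨h1, h0 i⟩

lemma kIndLE_of_DLE {k : ℕ} : ∀ (p : ℕ) (X : Type) [MetricSpace X], DLE X (k * p + k) →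
    KIndLE (bComplex k) X p := by
  intro p
  induction p with
  | zero =>
    intro X _ h
    rw [kIndLE_iff]
    intro F hF hK
    obtain ⟨Z, hZ, hc⟩ := h
    rw [isKTuple_bComplex] at hK
    obtain ⟨U, h1, h2, h3, h4⟩ := exists_nbhd_avoiding
      (fun i : Fin k => Z (i.cast (by simp))) (fun i => hZ _) F hF hK
    refine ⟨U, h1, (isKTuple_bComplex U).2 h2, h3, Or.inl ?_⟩
    rw [eq_empty_iff_forall_notMem]
    intro x hx
    have hxc : x ∈ ⋃ i, Z i := hc ▸ mem_univ x
    obtain ⟨i, hi⟩ := mem_iUnion.1 hxc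
    exact Set.disjoint_left.1 (h4 (i.cast (by simp))) hx (by simpa using hi)
  | succ p ih =>
    intro X _ h
    rw [kIndLE_iff]
    intro F hF hK
    obtain ⟨Z, hZ, hc⟩ := h
    rw [isKTuple_bComplex] at hK
    obtain ⟨U, h1, h2, h3, h4⟩ := exists_nbhd_avoiding
      (fun i : Fin k => Z (Fin.natAdd (k * (p + 1)) i)) (fun i => hZ _) F hF hK
    refine ⟨U, h1, (isKTuple_bComplex U).2 h2, h3, Or.inr ⟨p, by exact_mod_cast Nat.lt_succ_self p, ?_⟩⟩
    apply ih
    have hle : k * p + k = k * (p + 1) := by ring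
    rw [hle]
    refine DLE.of_closed (fun i : Fin (k * (p + 1)) => Z (Fin.castAdd k i)) (fun i => hZ _)
      (isOpen_iUnion h1).isClosed_compl ?_
    intro x hx
    have hxc : x ∈ ⋃ i, Z i := hc ▸ mem_univ x
    obtain ⟨i, hi⟩ := mem_iUnion.1 hxc
    revert hi
    refine Fin.addCases (fun i hi => mem_iUnion.2 ⟨i, hi⟩) (fun i hi => ?_) i
    exact absurd hi (Set.disjoint_left.1 (h4 i) hx)

/-- The obstruction-free partition. -/
lemma exists_nbhd_noObs {X : Type} [MetricSpace X] {k p : ℕ} (hk : 2 ≤ k)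
    (h : DLE X (k * (p + 1) + 1)) (F : Fin (k + 1) → Set X)
    (hF : ∀ i, IsClosed (F i)) (hFe : (⋂ i, F i) = ∅) :
    ∃ U : Fin (k + 1) → Set X, KNbhd (bComplex k) F U ∧ KObs (bComplex k) U = ∅ ∧
      KIndLE (bComplex k) (↥((⋃ i, U i)ᶜ)) p := by
  obtain ⟨D, hD, hDW, hDc⟩ := closedShrink (fun i => (F i)ᶜ) (fun i => (hF i).isOpen_compl)
    (by rw [← compl_iInter, hFe, compl_empty])
  have hcov : ∀ x, ∃ i, x ∈ D i := fun x => mem_iUnion.1 (hDc ▸ mem_univ x)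
  obtain ⟨Z, hZ, hc⟩ := h
  obtain ⟨N, hN1, hN2, hN3, hN4⟩ := hZ (Fin.last _) (⋂ i, D i) (⋂ i, (F i)ᶜ)
    (isClosed_iInter hD) (isOpen_iInter_of_finite fun i => (hF i).isOpen_compl)
    (iInter_mono hDW)
  have hlast : ∀ i : Fin (k + 1), ∃ j, j ≠ i ∧ j ≠ Fin.last k := by
    intro i
    by_cases h0 : i = 0
    · refine ⟨⟨1, by omega⟩, ?_, ?_⟩
      · rw [h0]; simp [Fin.ext_iff]
      · simp [Fin.ext_iff]; omega
    · refine ⟨0, Ne.symm h0, ?_⟩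
      simp [Fin.ext_iff]; omega
  set C : Fin (k + 1) → Set X := fun i => if i = Fin.last k then D i \ N else D i ∪ closure N
    with hCdef
  have hCl : C (Fin.last k) = D (Fin.last k) \ N := by simp [hCdef]
  have hCn : ∀ i, i ≠ Fin.last k → C i = D i ∪ closure N := fun i hi => by simp [hCdef, hi]
  have hCc : ∀ i, IsClosed (C i) := by
    intro i
    by_cases hi : i = Fin.last k
    · rw [hi, hCl]; exact (hD _).sdiff hN1
    · rw [hCn i hi]; exact (hD i).union isClosed_closure
  have hCW : ∀ i, C i ⊆ (F i)ᶜ := by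
    intro i
    by_cases hi : i = Fin.last k
    · rw [hi, hCl]; exact sdiff_subset.trans (hDW _)
    · rw [hCn i hi]; exact union_subset (hDW i) (hN3.trans (iInter_subset _ i))
  have hDC : ∀ i x, x ∈ D i → x ∉ N → x ∈ C i := by
    intro i x hx hxN
    by_cases hi : i = Fin.last k
    · rw [hi, hCl]; exact ⟨hi ▸ hx, hxN⟩
    · rw [hCn i hi]; exact Or.inl hx
  have hNC : ∀ i, i ≠ Fin.last k → ∀ x ∈ N, x ∈ C i := by
    intro i hi x hx
    rw [hCn i hi]; exact Or.inr (subset_closure hx)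
  have hP : (⋃ i, (C i)ᶜ)ᶜ = ⋂ i, C i := by simp [compl_iUnion]
  have hPf : (⋂ i, C i) ⊆ frontier N := by
    intro x hx
    rw [mem_iInter] at hx
    have hl := hx (Fin.last k)
    rw [hCl] at hl
    rw [hN1.frontier_eq]
    refine ⟨?_, hl.2⟩
    by_contra hcl
    refine hl.2 (hN2 (mem_iInter.2 fun i => ?_))
    by_cases hi : i = Fin.last k
    · rw [hi]; exact hl.1
    · have := hx i
      rw [hCn i hi] at this
      exact this.resolve_right hcl
  have hUe : (⋂ i, (C i)ᶜ) = ∅ := by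
    rw [eq_empty_iff_forall_notMem]
    intro x hx
    rw [mem_iInter] at hx
    by_cases hxN : x ∈ N
    · obtain ⟨j, _, hj⟩ := hlast 0
      exact hx j (hNC j hj x hxN)
    · obtain ⟨i, hi⟩ := hcov x
      exact hx i (hDC i x hi hxN)
  refine ⟨fun i => (C i)ᶜ, ⟨fun i => (hCc i).isOpen_compl, (isKTuple_bComplex _).2 hUe,
    fun i x hx hxC => hCW i hxC hx⟩, ?_, ?_⟩
  · rw [eq_empty_iff_forall_notMem]
    intro x hx
    apply hx
    by_cases hxP : x ∈ ⋂ i, C i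
    · have hxf := hPf hxP
      have hxN : x ∉ N := by
        rw [hN1.frontier_eq] at hxf; exact hxf.2
      obtain ⟨i, hi⟩ : ∃ i, x ∉ D i := by
        by_contra hcon
        push Not at hcon
        exact hxN (hN2 (mem_iInter.2 hcon))
      refine ⟨fun j => if j = i then (C j)ᶜ ∪ (D i)ᶜ else (C j)ᶜ, ⟨?_, ?_, ?_⟩, ?_⟩
      · intro j
        by_cases hj : j = i
        · simp only [hj, if_true]
          exact (hCc _).isOpen_compl.union (hD _).isOpen_compl
        · simp only [hj, if_false]
          exact (hCc _).isOpen_compl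
      · rw [isKTuple_bComplex, eq_empty_iff_forall_notMem]
        intro y hy
        rw [mem_iInter] at hy
        have hne : ∀ j, j ≠ i → y ∉ C j := by
          intro j hj
          have := hy j
          simpa [hj] using this
        by_cases hyi : y ∈ D i
        · have h1 := hy i
          simp only [if_true] at h1
          have h2 : y ∉ C i := h1.resolve_right (fun h => h hyi)
          have h3 : y ∈ ⋂ i, (C i)ᶜ := mem_iInter.2 fun j => by
            by_cases hj : j = i
            · rw [hj]; exact h2
            · exact hne j hj
          rw [hUe] at h3
          exact h3
        · by_cases hyN : y ∈ N
          · obtain ⟨j, hji, hj⟩ := hlast i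
            exact hne j hji (hNC j hj y hyN)
          · obtain ⟨j, hj⟩ := hcov y
            have hji : j ≠ i := by rintro rfl; exact hyi hj
            exact hne j hji (hDC j y hj hyN)
      · intro j y hy
        by_cases hj : j = i
        · simp only [hj, if_true]
          exact Or.inl (hj ▸ hy)
        · simpa [hj] using hy
      · refine mem_iUnion.2 ⟨i, ?_⟩
        simp only [if_true]
        exact Or.inr hi
    · rw [← hP, mem_compl_iff, not_not] at hxP
      exact ⟨_, ⟨fun i => (hCc i).isOpen_compl, (isKTuple_bComplex _).2 hUe, fun i => subset_rfl⟩,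
        hxP⟩
  · apply kIndLE_of_DLE
    have hle : k * p + k = k * (p + 1) := by ring
    rw [hle]
    refine DLE.of_closed (fun i => Z (Fin.castSucc i)) (fun i => hZ _)
      (isOpen_iUnion fun i => (hCc i).isOpen_compl).isClosed_compl ?_
    rw [hP]
    intro x hx
    have hxc : x ∈ ⋃ i, Z i := hc ▸ mem_univ x
    obtain ⟨i, hi⟩ := mem_iUnion.1 hxc
    revert hi
    refine Fin.lastCases (fun hi => ?_) (fun i hi => mem_iUnion.2 ⟨i, hi⟩) i
    exact absurd hi (Set.disjoint_left.1 hN4 (hPf hx))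

/-! ### Lower bound -/

lemma extendShrink {X ι : Type} [MetricSpace X] [Finite ι] (W : ι → Set X)
    (hW : ∀ i, IsOpen (W i)) (hc : (⋃ i, W i) = Set.univ) {Y : Set X} (hY : IsClosed Y)
    (C' : ι → Set X) (hC' : ∀ i, IsClosed (C' i)) (hCW : ∀ i, C' i ⊆ W i)
    (hYC : Y ⊆ ⋃ i, C' i) :
    ∃ C : ι → Set X, (∀ i, IsClosed (C i)) ∧ (∀ i, C i ⊆ W i) ∧ (⋃ i, C i) = Set.univ ∧
      ∀ i, C i ∩ Y ⊆ C' i := by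
  obtain ⟨D, hD, hDW, hDc⟩ := closedShrink W hW hc
  set E : ι → Set X := fun i => {x | ∀ j, Metric.infEDist x (C' i) ≤ Metric.infEDist x (C' j)}
    with hE
  have hEc : ∀ i, IsClosed (E i) := by
    intro i
    simp only [hE, Set.ofPred_forall]
    exact isClosed_iInter fun j =>
      isClosed_le Metric.continuous_infEDist Metric.continuous_infEDist
  have hEY : ∀ i, ∀ x ∈ Y, x ∈ E i → x ∈ C' i := by
    intro i x hx hxE
    obtain ⟨j, hj⟩ := mem_iUnion.1 (hYC hx)
    rw [Metric.mem_iff_infEDist_zero_of_closed (hC' i)]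
    have := hxE j
    rw [Metric.infEDist_zero_of_mem hj] at this
    exact le_antisymm this bot_le
  have hT : IsClosed (⋃ i, E i \ W i) := isClosed_iUnion_of_finite fun i => (hEc i).sdiff (hW i)
  obtain ⟨O, hO, hYO, hOT⟩ := normal_exists_closure_subset hY hT.isOpen_compl (by
    intro x hx hxT
    obtain ⟨i, hi, hi'⟩ := mem_iUnion.1 hxT
    exact hi' (hCW i (hEY i x hx hi)))
  refine ⟨fun i => (E i ∩ closure O) ∪ (D i \ O), fun i =>
    ((hEc i).inter isClosed_closure).union ((hD i).sdiff hO), ?_, ?_, ?_⟩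
  · rintro i x (⟨h1, h2⟩ | ⟨h1, h2⟩)
    · by_contra hx
      exact hOT h2 (mem_iUnion.2 ⟨i, h1, hx⟩)
    · exact hDW i h1
  · refine eq_univ_of_forall fun x => ?_
    obtain ⟨i, hi⟩ : ∃ i, x ∈ D i := mem_iUnion.1 (hDc ▸ mem_univ x)
    by_cases hx : x ∈ O
    · have : Nonempty ι := ⟨i⟩
      obtain ⟨j, hj⟩ := Finite.exists_min (fun j => Metric.infEDist x (C' j))
      exact mem_iUnion.2 ⟨j, Or.inl ⟨hj, subset_closure hx⟩⟩
    · exact mem_iUnion.2 ⟨i, Or.inr ⟨hi, hx⟩⟩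
  · rintro i x ⟨⟨h1, h2⟩ | ⟨h1, h2⟩, hxY⟩
    · exact hEY i x hxY h1
    · exact absurd (hYO hxY) h2

lemma kIndLE_kdim {k : ℕ} : ∀ (p : ℕ) (X : Type) [MetricSpace X], KIndLE (bComplex k) X p →
    ∀ W : Fin (p + 1) → Fin (k + 1) → Set X, (∀ j i, IsOpen (W j i)) →
      (∀ j, (⋃ i, W j i) = Set.univ) →
    ∃ C : Fin (p + 1) → Fin (k + 1) → Set X, (∀ j i, IsClosed (C j i)) ∧
      (∀ j i, C j i ⊆ W j i) ∧ (∀ j, (⋃ i, C j i) = Set.univ) ∧ (⋂ j, ⋂ i, C j i) = ∅ := by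
  intro p
  induction p with
  | zero =>
    intro X _ h W hW hc
    rw [kIndLE_iff] at h
    obtain ⟨U, h1, h2, h3, h4⟩ := h (fun i => (W 0 i)ᶜ) (fun i => (hW 0 i).isClosed_compl)
      ((isKTuple_bComplex _).2 (by rw [← compl_iUnion, hc, compl_univ]))
    rw [isKTuple_bComplex] at h2
    have h5 : (⋃ i, U i)ᶜ = ∅ := by
      refine h4.resolve_right ?_
      rintro ⟨β, hβ, _⟩
      simp at hβ
    refine ⟨fun _ i => (U i)ᶜ, fun _ i => (h1 i).isClosed_compl, ?_, ?_, ?_⟩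
    · intro j i
      have hj0 : j = 0 := Fin.ext (by omega)
      rw [hj0]
      exact compl_subset_comm.1 (h3 i)
    · intro j
      rw [← compl_iInter, h2, compl_empty]
    · rw [eq_empty_iff_forall_notMem]
      intro x hx
      rw [← mem_empty_iff_false x, ← h5, compl_iUnion]
      exact mem_iInter.1 hx 0
  | succ p ih =>
    intro X _ h W hW hc
    rw [kIndLE_iff] at h
    obtain ⟨U, h1, h2, h3, h4⟩ := h (fun i => (W 0 i)ᶜ) (fun i => (hW 0 i).isClosed_compl)
      ((isKTuple_bComplex _).2 (by rw [← compl_iUnion, hc, compl_univ]))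
    rw [isKTuple_bComplex] at h2
    set Y : Set X := (⋃ i, U i)ᶜ with hYdef
    have hY : IsClosed Y := (isOpen_iUnion h1).isClosed_compl
    have hYK : KIndLE (bComplex k) Y p := by
      rcases h4 with h4 | ⟨β, hβ, h4⟩
      · rw [kIndLE_iff]
        intro F hF hK
        refine ⟨fun _ => ∅, fun _ => isOpen_empty, (isKTuple_bComplex _).2 ?_, ?_, Or.inl ?_⟩
        · exact iInter_const _
        · intro i x
          exact absurd (h4.subset x.2) (notMem_empty _)
        · rw [eq_empty_iff_forall_notMem]
          intro x
          exact absurd (h4.subset x.2) (notMem_empty _)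
      · refine kIndLE_mono ?_ h4
        have : β < Order.succ (p : Ordinal.{0}) := by simpa using hβ
        exact Order.lt_succ_iff.1 this
    obtain ⟨C', hC1, hC2, hC3, hC4⟩ := ih Y hYK (fun j i => (↑) ⁻¹' (W j.succ i))
      (fun j i => (hW _ _).preimage continuous_subtype_val)
      (fun j => by rw [← preimage_iUnion, hc, preimage_univ])
    have key := fun j : Fin (p + 1) => extendShrink (W j.succ) (hW _) (hc _) hY
      (fun i => ((↑) '' (C' j i) : Set X))
      (fun i => hY.isClosedEmbedding_subtypeVal.isClosedMap _ (hC1 j i))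
      (fun i => by rintro _ ⟨x, hx, rfl⟩; exact hC2 j i hx)
      (by
        intro x hx
        have : (⟨x, hx⟩ : Y) ∈ ⋃ i, C' j i := by rw [hC3]; trivial
        obtain ⟨i, hi⟩ := mem_iUnion.1 this
        exact mem_iUnion.2 ⟨i, ⟨x, hx⟩, hi, rfl⟩)
    choose C hCc hCW hCu hCY using key
    refine ⟨Fin.cons (fun i => (U i)ᶜ) C, ?_, ?_, ?_, ?_⟩
    · intro j i
      refine Fin.cases ?_ (fun j => ?_) j
      · simpa using (h1 i)
      · simpa using hCc j i
    · intro j i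
      refine Fin.cases ?_ (fun j => ?_) j
      · simpa using compl_subset_comm.1 (h3 i)
      · simpa using hCW j i
    · intro j
      refine Fin.cases ?_ (fun j => ?_) j
      · simp only [Fin.cons_zero]
        rw [← compl_iInter, h2, compl_empty]
      · simpa using hCu j
    · rw [eq_empty_iff_forall_notMem]
      intro x hx
      simp only [mem_iInter] at hx
      have hxY : x ∈ Y := by
        rw [hYdef, compl_iUnion, mem_iInter]
        intro i
        simpa using hx 0 i
      have : (⟨x, hxY⟩ : Y) ∈ ⋂ j, ⋂ i, C' j i := by
        simp only [mem_iInter]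
        intro j i
        have h6 := hx j.succ i
        simp only [Fin.cons_succ] at h6
        obtain ⟨y, hy, hyx⟩ := hCY j i ⟨h6, hxY⟩
        have : y = ⟨x, hxY⟩ := Subtype.ext hyx
        exact this ▸ hy
      rw [hC4] at this
      exact this

/-- Every cover with `k (p+1) + 1` members has an open shrinking with empty intersection. -/
lemma kIndLE_shrink {k p : ℕ} {X : Type} [MetricSpace X] (h : KIndLE (bComplex k) X p)
    (W : Option (Fin (p + 1) × Fin k) → Set X) (hW : ∀ a, IsOpen (W a))
    (hc : (⋃ a, W a) = Set.univ) :
    ∃ V : Option (Fin (p + 1) × Fin k) → Set X, (∀ a, IsOpen (V a)) ∧ (∀ a, V a ⊆ W a) ∧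
      (⋃ a, V a) = Set.univ ∧ (⋂ a, V a) = ∅ := by
  obtain ⟨B, hB, hBW, hBc⟩ := closedShrink W hW hc
  obtain ⟨C, hC1, hC2, hC3, hC4⟩ := kIndLE_kdim p X h
    (fun j => Fin.cons ((⋃ i, B (some (j, i)))ᶜ) (fun i => W (some (j, i))))
    (by
      intro j i
      refine Fin.cases ?_ (fun i => ?_) i
      · simp only [Fin.cons_zero]
        exact (isClosed_iUnion_of_finite fun i => hB _).isOpen_compl
      · simpa using hW _)
    (by
      intro j
      refine eq_univ_of_forall fun x => ?_
      by_cases hx : x ∈ ⋃ i, B (some (j, i))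
      · obtain ⟨i, hi⟩ := mem_iUnion.1 hx
        refine mem_iUnion.2 ⟨i.succ, ?_⟩
        simpa using hBW _ hi
      · exact mem_iUnion.2 ⟨0, hx⟩)
  set E : Option (Fin (p + 1) × Fin k) → Set X := fun a =>
    a.elim (⋂ j, C j 0) (fun q => C q.1 q.2.succ) with hE
  have hEc : ∀ a, IsClosed (E a) := by
    rintro (_ | q)
    · exact isClosed_iInter fun j => hC1 j 0
    · exact hC1 _ _
  have hEu : ∀ x, ∃ a, x ∈ E a := by
    intro x
    by_cases hx : x ∈ E none
    · exact ⟨none, hx⟩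
    · simp only [hE, Option.elim_none, mem_iInter, not_forall] at hx
      obtain ⟨j, hj⟩ := hx
      obtain ⟨i, hi⟩ : ∃ i, x ∈ C j i := mem_iUnion.1 (hC3 j ▸ mem_univ x)
      revert hi
      refine Fin.cases (fun hi => absurd hi hj) (fun i hi => ?_) i
      exact ⟨some (j, i), hi⟩
  have hEW : ∀ a, E a ⊆ W a := by
    rintro (_ | ⟨j, i⟩) x hx
    · obtain ⟨a, ha⟩ : ∃ a, x ∈ B a := mem_iUnion.1 (hBc ▸ mem_univ x)
      rcases a with _ | ⟨j, i⟩
      · exact hBW _ ha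
      · have h1 := hC2 j 0 (mem_iInter.1 hx j)
        simp only [Fin.cons_zero] at h1
        exact absurd (mem_iUnion.2 ⟨i, ha⟩) h1
    · have := hC2 j i.succ hx
      simpa using this
  have hEe : (⋂ a, E a) = ∅ := by
    rw [eq_empty_iff_forall_notMem]
    intro x hx
    rw [mem_iInter] at hx
    rw [← mem_empty_iff_false x, ← hC4]
    simp only [mem_iInter]
    intro j i
    refine Fin.cases ?_ (fun i => ?_) i
    · exact mem_iInter.1 (hx none) j
    · exact hx (some (j, i))
  obtain ⟨D, hD, hDE, hDc⟩ := closedShrink (fun a => (E a)ᶜ) (fun a => (hEc a).isOpen_compl)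
    (by rw [← compl_iInter, hEe, compl_empty])
  refine ⟨fun a => (D a)ᶜ ∩ W a, fun a => (hD a).isOpen_compl.inter (hW a),
    fun a => inter_subset_right, ?_, ?_⟩
  · refine eq_univ_of_forall fun x => ?_
    obtain ⟨a, ha⟩ := hEu x
    exact mem_iUnion.2 ⟨a, fun hx => hDE a hx ha, hEW a ha⟩
  · rw [eq_empty_iff_forall_notMem]
    intro x hx
    obtain ⟨a, ha⟩ : ∃ a, x ∈ D a := mem_iUnion.1 (hDc ▸ mem_univ x)
    exact (mem_iInter.1 hx a).1 ha

lemma kIndLE_shrink_one {k p : ℕ} {X : Type} [MetricSpace X] (h : KIndLE (bComplex k) X p)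
    {ι : Type} [Finite ι] (W : ι → Set X) (hW : ∀ i, IsOpen (W i)) (hc : (⋃ i, W i) = Set.univ)
    (I : Finset ι) (hI : I.card = k * (p + 1) + 1) :
    ∃ V : ι → Set X, (∀ i, IsOpen (V i)) ∧ (∀ i, V i ⊆ W i) ∧ (⋃ i, V i) = Set.univ ∧
      (⋂ i ∈ I, V i) = ∅ := by
  have hcard : Fintype.card (Option (Fin (p + 1) × Fin k)) = Fintype.card I := by
    simp [hI, mul_comm]
  have e : Option (Fin (p + 1) × Fin k) ≃ I := Fintype.equivOfCardEq hcard
  obtain ⟨V', h1, h2, h3, h4⟩ := kIndLE_shrink h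
    (fun a => a.elim (W (e none) ∪ ⋃ j : {j // j ∉ I}, W j) (fun q => W (e (some q))))
    (by
      rintro (_ | q)
      · exact (hW _).union (isOpen_iUnion fun j => hW _)
      · exact hW _)
    (by
      refine eq_univ_of_forall fun x => ?_
      obtain ⟨i, hi⟩ : ∃ i, x ∈ W i := mem_iUnion.1 (hc ▸ mem_univ x)
      by_cases hiI : i ∈ I
      · obtain ⟨a, ha⟩ := e.surjective ⟨i, hiI⟩
        refine mem_iUnion.2 ⟨a, ?_⟩
        have hx : x ∈ W (e a) := by rw [ha]; exact hi
        rcases a with _ | q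
        · exact Or.inl hx
        · exact hx
      · exact mem_iUnion.2 ⟨none, Or.inr (mem_iUnion.2 ⟨⟨i, hiI⟩, hi⟩)⟩)
  refine ⟨fun i => if hi : i ∈ I then W i ∩ V' (e.symm ⟨i, hi⟩) else W i ∩ V' none, ?_, ?_, ?_, ?_⟩
  · intro i
    by_cases hi : i ∈ I
    · simp only [hi, dif_pos]; exact (hW i).inter (h1 _)
    · simp only [hi, dif_neg, not_false_eq_true]; exact (hW i).inter (h1 _)
  · intro i
    by_cases hi : i ∈ I
    · simp only [hi, dif_pos]; exact inter_subset_left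
    · simp only [hi, dif_neg, not_false_eq_true]; exact inter_subset_left
  · have hgo : ∀ x a, x ∈ V' a → x ∈ W (e a) → x ∈ ⋃ i, (if hi : i ∈ I then
        W i ∩ V' (e.symm ⟨i, hi⟩) else W i ∩ V' none) := by
      intro x a hx hxW
      refine mem_iUnion.2 ⟨(e a : ι), ?_⟩
      rw [dif_pos (e a).2]
      exact ⟨hxW, by simpa using hx⟩
    refine eq_univ_of_forall fun x => ?_
    obtain ⟨a, ha⟩ : ∃ a, x ∈ V' a := mem_iUnion.1 (h3 ▸ mem_univ x)
    have ha2 := h2 a ha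
    rcases a with _ | q
    · rcases ha2 with ha2 | ha2
      · exact hgo x _ ha ha2
      · obtain ⟨⟨j, hj⟩, hxj⟩ := mem_iUnion.1 ha2
        refine mem_iUnion.2 ⟨j, ?_⟩
        rw [dif_neg hj]
        exact ⟨hxj, ha⟩
    · exact hgo x _ ha ha2
  · rw [eq_empty_iff_forall_notMem]
    intro x hx
    rw [← mem_empty_iff_false x, ← h4, mem_iInter]
    intro a
    have := mem_iInter₂.1 hx (e a : ι) (e a).2
    beta_reduce at this
    rw [dif_pos (e a).2] at this
    simpa using this.2

lemma kIndLE_covDim {k p : ℕ} {X : Type} [MetricSpace X] (h : KIndLE (bComplex k) X p)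
    (m : ℕ) (hm : k * (p + 1) ≤ m + 1) : CovDimLE X m := by
  intro ι hι W hW hc
  have key : ∀ S : Finset (Finset ι), (∀ I ∈ S, I.card = k * (p + 1) + 1) →
      ∃ V : ι → Set X, (∀ i, IsOpen (V i)) ∧ (∀ i, V i ⊆ W i) ∧ (⋃ i, V i) = Set.univ ∧
        ∀ I ∈ S, (⋂ i ∈ I, V i) = ∅ := by
    intro S
    induction S using Finset.induction_on with
    | empty => exact fun _ => ⟨W, hW, fun _ => subset_rfl, hc, by simp⟩
    | insert I S hIS ih =>
      intro hS
      obtain ⟨V, h1, h2, h3, h4⟩ := ih fun J hJ => hS J (Finset.mem_insert_of_mem hJ)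
      obtain ⟨V', h1', h2', h3', h4'⟩ := kIndLE_shrink_one h V h1 h3 I
        (hS I (Finset.mem_insert_self _ _))
      refine ⟨V', h1', fun i => (h2' i).trans (h2 i), h3', ?_⟩
      intro J hJ
      rcases Finset.mem_insert.1 hJ with rfl | hJ
      · exact h4'
      · exact subset_eq_empty (iInter₂_mono fun i _ => h2' i) (h4 J hJ)
  have := Fintype.ofFinite ι
  obtain ⟨V, h1, h2, h3, h4⟩ := key (Finset.univ.filter fun I => I.card = k * (p + 1) + 1)
    (by simp)
  refine ⟨V, h1, h2, h3, fun x => ?_⟩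
  by_contra hcon
  rw [Set.ncard_eq_toFinset_card'] at hcon
  obtain ⟨I, hI1, hI2⟩ := Finset.exists_subset_card_eq
    (show k * (p + 1) + 1 ≤ (Set.toFinset {i | x ∈ V i}).card by omega)
  have := h4 I (by simp [hI2])
  rw [eq_empty_iff_forall_notMem] at this
  refine this x (mem_iInter₂.2 fun i hi => ?_)
  simpa using hI1 hi

/-! ### Generic points -/

lemma hull_null {J : Type} [Fintype J] {m : ℕ} (hJ : Fintype.card J = m + 1)
    (S : Finset (J → ℝ)) (hS : S.card ≤ m + 1) :
    MeasureTheory.volume (convexHull ℝ (S : Set (J → ℝ))) = 0 := by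
  rcases S.eq_empty_or_nonempty with rfl | hne
  · simp
  refine MeasureTheory.measure_mono_null (convexHull_subset_affineSpan _) ?_
  apply MeasureTheory.Measure.addHaar_affineSubspace
  intro htop
  obtain ⟨n, hn⟩ : ∃ n, S.card = n + 1 := ⟨S.card - 1, by have := hne.card_pos; omega⟩
  have h1 := finrank_vectorSpan_image_finset_le ℝ (id : (J → ℝ) → (J → ℝ)) S hn
  rw [Finset.image_id, ← direction_affineSpan, htop, AffineSubspace.direction_top, finrank_top,
    Module.finrank_fintype_fun_eq_card] at h1
  omega

lemma generic_point {J : Type} [Fintype J] {m : ℕ} (hJ : Fintype.card J = m + 1)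
    (T : Finset (Finset (J → ℝ))) (hT : ∀ S ∈ T, S.card ≤ m + 1) :
    ∃ (c : J → ℝ) (δ : ℝ), 0 < δ ∧ (∀ i, 0 < c i - δ / 2 ∧ c i + δ / 2 < 1) ∧
      ∀ S ∈ T, ∀ y ∈ convexHull ℝ (S : Set (J → ℝ)), δ ≤ dist y c := by
  set O : Set (J → ℝ) := Set.pi Set.univ (fun _ => Set.Ioo (0 : ℝ) 1) with hO
  set D : Set (J → ℝ) := ⋃ S ∈ T, convexHull ℝ (S : Set (J → ℝ)) with hD
  have hOo : IsOpen O := isOpen_set_pi Set.finite_univ (fun _ _ => isOpen_Ioo)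
  have hOn : O.Nonempty := ⟨fun _ => 1 / 2, by intro i _; constructor <;> norm_num⟩
  have hDc : IsClosed D := by
    apply T.finite_toSet.isClosed_biUnion
    intro S _
    exact S.finite_toSet.isClosed_convexHull ℝ
  have hD0 : MeasureTheory.volume D = 0 := by
    refine (MeasureTheory.measure_biUnion_null_iff T.countable_toSet).2 ?_
    exact fun S hS => hull_null hJ S (hT S hS)
  have hne : (O ∩ Dᶜ).Nonempty := by
    by_contra hcon
    rw [Set.not_nonempty_iff_eq_empty] at hcon
    have hsub : O ⊆ D := by
      intro x hx
      by_contra hxD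
      have : x ∈ O ∩ Dᶜ := ⟨hx, hxD⟩
      rw [hcon] at this
      exact this
    have h1 := hOo.measure_pos MeasureTheory.volume hOn
    exact h1.ne' (MeasureTheory.measure_mono_null hsub hD0)
  obtain ⟨c, hc⟩ := hne
  obtain ⟨δ, hδ, hb⟩ := Metric.isOpen_iff.1 (hOo.inter hDc.isOpen_compl) c hc
  refine ⟨c, δ, hδ, ?_, ?_⟩
  · have hp : ∀ t : ℝ, |t| = δ / 2 → (fun i => c i + t) ∈ O := by
      intro t ht
      refine (hb ?_).1
      rw [Metric.mem_ball, dist_pi_lt_iff hδ]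
      intro i
      rw [Real.dist_eq]
      simp [ht, hδ]
    intro i
    have h1 := hp (δ / 2) (abs_of_pos (by linarith)) i (Set.mem_univ i)
    have h2 := hp (-(δ / 2)) (by rw [abs_neg]; exact abs_of_pos (by linarith)) i (Set.mem_univ i)
    simp only [Set.mem_Ioo] at h1 h2
    constructor <;> linarith [h1.1, h1.2, h2.1, h2.2]
  · intro S hS y hy
    by_contra hlt
    push Not at hlt
    exact (hb (Metric.mem_ball.2 hlt)).2 (Set.mem_biUnion (x := S) hS hy)

lemma finpairs {X J : Type} [MetricSpace X] [Fintype J] {m : ℕ} (hX : CovDimLE X m)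
    (hJ : Fintype.card J = m + 1) (F W : J → Set X) (hF : ∀ i, IsClosed (F i))
    (hW : ∀ i, IsOpen (W i)) (hFW : ∀ i, F i ⊆ W i) :
    ∃ A B : J → Set X, (∀ i, IsOpen (A i)) ∧ (∀ i, IsOpen (B i)) ∧ (∀ i, F i ⊆ A i) ∧
      (∀ i, closure (A i) ⊆ B i) ∧ (∀ i, B i ⊆ W i) ∧
      ∀ x, ∃ i, x ∉ closure (B i) \ A i := by
  obtain ⟨V, hVo, hVs, hVc, hVn⟩ := hX (J → Bool) inferInstance
    (fun ε => ⋂ i, if ε i then W i else (F i)ᶜ)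
    (fun ε => isOpen_iInter_of_finite (fun i => by
      by_cases hε : ε i
      · simpa [hε] using hW i
      · simpa [hε] using (hF i)))
    (by
      rw [Set.eq_univ_iff_forall]
      intro x
      refine Set.mem_iUnion.2 ⟨fun i => decide (x ∈ W i), Set.mem_iInter.2 fun i => ?_⟩
      by_cases hx : x ∈ W i
      · simp [hx]
      · simpa [hx] using fun h => hx (hFW i h))
  obtain ⟨ρ, hρ⟩ := PartitionOfUnity.exists_isSubordinate_of_locallyFinite isClosed_univ V hVo
    (locallyFinite_of_finite _) (by rw [hVc])
  set v : (J → Bool) → J → ℝ := fun ε i => if ε i then 1 else 0 with hv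
  have hsum : ∀ x, ∑ ε, ρ ε x = 1 := by
    intro x
    have := ρ.sum_eq_one (Set.mem_univ x)
    rwa [finsum_eq_sum_of_fintype] at this
  have hsupp : ∀ ε x, x ∉ V ε → ρ ε x = 0 := by
    intro ε x hx
    by_contra h0
    exact hx (hρ ε (subset_tsupport _ h0))
  set g : X → J → ℝ := fun x i => ∑ ε, ρ ε x * v ε i with hg
  have hgc : ∀ i, Continuous (fun x => g x i) := by
    intro i
    simp only [hg]
    fun_prop
  have hg1 : ∀ i, ∀ x ∈ F i, g x i = 1 := by
    intro i x hx
    rw [← hsum x]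
    refine Finset.sum_congr rfl fun ε _ => ?_
    by_cases hxV : x ∈ V ε
    · have h2 := Set.mem_iInter.1 (hVs ε hxV) i
      by_cases hε : ε i
      · simp [hv, hε]
      · simp [hε] at h2
        exact absurd hx h2
    · rw [hsupp ε x hxV, zero_mul]
  have hg0 : ∀ i, ∀ x, x ∉ W i → g x i = 0 := by
    intro i x hx
    refine Finset.sum_eq_zero fun ε _ => ?_
    by_cases hxV : x ∈ V ε
    · have h2 := Set.mem_iInter.1 (hVs ε hxV) i
      by_cases hε : ε i
      · simp [hε] at h2
        exact absurd h2 hx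
      · simp [hv, hε]
    · rw [hsupp ε x hxV, zero_mul]
  set T : Finset (Finset (J → ℝ)) :=
    (Finset.univ.filter (fun S : Finset (J → Bool) => S.card ≤ m + 1)).image
      (fun S => S.image v) with hT
  obtain ⟨c, δ, hδ, hc, hcT⟩ := generic_point hJ T (by
    intro S hS
    obtain ⟨S', hS', rfl⟩ := Finset.mem_image.1 hS
    exact Finset.card_image_le.trans (Finset.mem_filter.1 hS').2)
  have hfar : ∀ x, δ ≤ dist (g x) c := by
    intro x
    set S : Finset (J → Bool) := Finset.univ.filter (fun ε => x ∈ V ε) with hS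
    have hScard : S.card ≤ m + 1 := by
      have h1 := hVn x
      rw [Set.ncard_eq_toFinset_card'] at h1
      convert h1 using 2
      ext ε
      simp [hS]
    refine hcT (S.image v) (Finset.mem_image.2 ⟨S, by simp [hScard], rfl⟩) (g x) ?_
    have hgx : g x = ∑ ε ∈ S, ρ ε x • v ε := by
      have h1 : g x = ∑ ε, ρ ε x • v ε := by
        ext i
        simp [hg, Finset.sum_apply]
      rw [h1]
      symm
      refine Finset.sum_subset (Finset.subset_univ S) ?_
      intro ε _ hε
      rw [hsupp ε x (by simpa [hS] using hε), zero_smul]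
    rw [hgx]
    refine (convex_convexHull ℝ _).sum_mem (fun ε _ => ρ.nonneg ε x) ?_ ?_
    · rw [← hsum x]
      refine Finset.sum_subset (Finset.subset_univ S) ?_
      intro ε _ hε
      exact hsupp ε x (by simpa [hS] using hε)
    · intro ε hε
      exact subset_convexHull ℝ _ (by simpa using ⟨ε, hε, rfl⟩)
  refine ⟨fun i => {x | c i + δ / 2 < g x i}, fun i => {x | c i - δ / 2 < g x i}, ?_, ?_, ?_, ?_,
    ?_, ?_⟩
  · exact fun i => isOpen_lt continuous_const (hgc i)
  · exact fun i => isOpen_lt continuous_const (hgc i)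
  · intro i x hx
    simp only [Set.mem_ofPred_eq, hg1 i x hx]
    exact (hc i).2
  · intro i x hx
    have h1 : x ∈ {x | c i + δ / 2 ≤ g x i} :=
      closure_minimal (fun y hy => le_of_lt hy) (isClosed_le continuous_const (hgc i)) hx
    simp only [Set.mem_ofPred_eq] at h1 ⊢
    linarith
  · intro i x hx
    by_contra hxW
    simp only [Set.mem_ofPred_eq, hg0 i x hxW] at hx
    linarith [(hc i).1]
  · intro x
    by_contra hcon
    push Not at hcon
    have h2 : dist (g x) c ≤ δ / 2 := by
      rw [dist_pi_le_iff (by linarith)]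
      intro i
      obtain ⟨ha, hb⟩ := hcon i
      have h1 : x ∈ {x | c i - δ / 2 ≤ g x i} :=
        closure_minimal (fun y hy => le_of_lt hy) (isClosed_le continuous_const (hgc i)) ha
      simp only [Set.mem_ofPred_eq, not_lt] at h1 hb
      rw [Real.dist_eq, abs_le]
      constructor <;> linarith
    linarith [hfar x]

/-! ### Countable families of partitions -/

/-- Pairs of open families used in the construction below. -/
structure PairSt (X ι : Type) [TopologicalSpace X] where
  /-- lower sets -/
  A : ι → Set X
  /-- upper sets -/
  B : ι → Set X
  oA : ∀ i, IsOpen (A i)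
  oB : ∀ i, IsOpen (B i)
  cl : ∀ i, closure (A i) ⊆ B i

lemma pairStep {X ι : Type} [MetricSpace X] {m : ℕ} (hX : CovDimLE X m)
    (s : PairSt X ι) (I : Finset ι) :
    ∃ t : PairSt X ι, (∀ i, s.A i ⊆ t.A i) ∧ (∀ i, t.B i ⊆ s.B i) ∧
      (I.card = m + 1 → ∀ x, ∃ i ∈ I, x ∉ closure (t.B i) \ t.A i) := by
  by_cases hI : I.card = m + 1
  · obtain ⟨A, B, h1, h2, h3, h4, h5, h6⟩ := finpairs hX (J := I) (by simpa using hI)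
      (fun i => closure (s.A i)) (fun i => s.B i) (fun i => isClosed_closure)
      (fun i => s.oB i) (fun i => s.cl i)
    refine ⟨⟨fun i => if h : i ∈ I then A ⟨i, h⟩ else s.A i,
      fun i => if h : i ∈ I then B ⟨i, h⟩ else s.B i, ?_, ?_, ?_⟩, ?_, ?_, ?_⟩
    · intro i
      by_cases h : i ∈ I
      · simpa [h] using h1 _
      · simpa [h] using s.oA i
    · intro i
      by_cases h : i ∈ I
      · simpa [h] using h2 _
      · simpa [h] using s.oB i
    · intro i
      by_cases h : i ∈ I
      · simpa [h] using h4 _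
      · simpa [h] using s.cl i
    · intro i
      by_cases h : i ∈ I
      · simpa [h] using subset_closure.trans (h3 ⟨i, h⟩)
      · simp [h]
    · intro i
      by_cases h : i ∈ I
      · simpa [h] using h5 ⟨i, h⟩
      · simp [h]
    · intro _ x
      obtain ⟨⟨i, hi⟩, hx⟩ := h6 x
      refine ⟨i, hi, ?_⟩
      simpa [hi] using hx
  · exact ⟨s, fun _ => subset_rfl, fun _ => subset_rfl, fun h => absurd h hI⟩

lemma seqPartitions {X ι : Type} [MetricSpace X] [Countable ι] {m : ℕ} (hX : CovDimLE X m)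
    (F W : ι → Set X) (hF : ∀ i, IsClosed (F i)) (hW : ∀ i, IsOpen (W i))
    (hFW : ∀ i, F i ⊆ W i) :
    ∃ N : ι → Set X, (∀ i, IsOpen (N i)) ∧ (∀ i, F i ⊆ N i) ∧ (∀ i, closure (N i) ⊆ W i) ∧
      ∀ I : Finset ι, I.card = m + 1 → ∀ x, ∃ i ∈ I, x ∉ frontier (N i) := by
  choose B0 hB0 hFB hBW using fun i => normal_exists_closure_subset (hF i) (hW i) (hFW i)
  choose A0 hA0 hFA hAB using fun i => normal_exists_closure_subset (hF i) (hB0 i) (hFB i)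
  obtain ⟨e, he⟩ := exists_surjective_nat (Finset ι)
  choose step hs1 hs2 hs3 using fun (s : PairSt X ι) (I : Finset ι) => pairStep hX s I
  let S : ℕ → PairSt X ι := fun n =>
    Nat.rec ⟨A0, B0, hA0, hB0, hAB⟩ (fun n s => step s (e n)) n
  have hS : ∀ n, S (n + 1) = step (S n) (e n) := fun n => rfl
  have hmA : ∀ i, Monotone (fun n => (S n).A i) := fun i =>
    monotone_nat_of_le_succ (fun n => by rw [hS]; exact hs1 _ _ i)
  have hmB : ∀ i, Antitone (fun n => (S n).B i) := fun i =>
    antitone_nat_of_succ_le (fun n => by rw [hS]; exact hs2 _ _ i)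
  have hNB : ∀ i n, (⋃ k, (S k).A i) ⊆ (S n).B i := by
    intro i n
    refine Set.iUnion_subset fun k => ?_
    intro x hx
    have h1 := hmA i (le_max_left k n) hx
    exact hmB i (le_max_right k n) ((S (max k n)).cl i (subset_closure h1))
  refine ⟨fun i => ⋃ n, (S n).A i, ?_, ?_, ?_, ?_⟩
  · exact fun i => isOpen_iUnion fun n => (S n).oA i
  · exact fun i => (hFA i).trans (Set.subset_iUnion (fun n => (S n).A i) 0)
  · exact fun i => (closure_mono (hNB i 0)).trans (hBW i)
  · intro I hI x
    obtain ⟨n, rfl⟩ := he I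
    obtain ⟨i, hi, hx⟩ := hs3 (S n) (e n) hI x
    refine ⟨i, hi, fun hxf => hx ⟨?_, ?_⟩⟩
    · exact closure_mono (hNB i (n + 1)) (frontier_subset_closure hxf)
    · intro hxA
      rw [(isOpen_iUnion fun n => (S n).oA i).frontier_eq] at hxf
      exact hxf.2 (Set.mem_iUnion.2 ⟨n + 1, hxA⟩)

/-! ### A sigma-discrete base -/

lemma sigmaBase (X : Type) [MetricSpace X] :
    ∃ (F : ℕ × ℕ → Set X) (W : ℕ × ℕ → X → Set X), (∀ j, IsClosed (F j)) ∧
      (∀ j x, IsOpen (W j x)) ∧ (∀ j x y, x ≠ y → Disjoint (W j x) (W j y)) ∧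
      (∀ j, F j ⊆ ⋃ x, W j x) ∧
      ∀ x : X, ∀ ε > 0, ∃ j, x ∈ F j ∧ ∀ y, ∀ u ∈ W j y, ∀ v ∈ W j y, dist u v < ε := by
  let r : ℕ → ℝ := fun n => 1 / ((n : ℝ) + 1)
  have hr : ∀ n, 0 < r n := fun n => Nat.one_div_pos_of_nat
  let E : ℕ × ℕ → X → Set X := fun j x =>
    {y | dist y x < r j.1 ∧ (∀ x', WellOrderingRel x' x → r j.1 ≤ dist y x') ∧
      ∀ z, dist z y < r j.2 → dist z x < r j.1}
  let W : ℕ × ℕ → X → Set X := fun j x => {u | ∃ y ∈ E j x, dist u y < r j.2 / 3}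
  have hWb : ∀ j x u, u ∈ W j x → dist u x < r j.1 := by
    rintro j x u ⟨y, hy, hu⟩
    exact hy.2.2 u (by linarith [hr j.2])
  have hkey : ∀ j x y, WellOrderingRel x y → Disjoint (W j x) (W j y) := by
    intro j x y hxy
    rw [Set.disjoint_left]
    rintro u ⟨a, ha, hua⟩ ⟨b, hb, hub⟩
    have h1 : dist b a < r j.2 := by
      have := dist_triangle_left b a u
      linarith [hr j.2]
    have h2 := ha.2.2 b h1
    have h3 := hb.2.1 x hxy
    linarith
  have hsub : ∀ j, closure (⋃ x, E j x) ⊆ ⋃ x, W j x := by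
    intro j u hu
    obtain ⟨y, hy, hd⟩ := Metric.mem_closure_iff.1 hu (r j.2 / 3) (by linarith [hr j.2])
    obtain ⟨x, hx⟩ := Set.mem_iUnion.1 hy
    exact Set.mem_iUnion.2 ⟨x, y, hx, hd⟩
  refine ⟨fun j => closure (⋃ x, E j x), W, fun _ => isClosed_closure, ?_, ?_, hsub, ?_⟩
  · intro j x
    have : W j x = ⋃ y ∈ E j x, Metric.ball y (r j.2 / 3) := by
      ext u
      simp [W]
    rw [this]
    exact isOpen_biUnion fun _ _ => Metric.isOpen_ball
  · intro j x y hxy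
    rcases trichotomous_of WellOrderingRel x y with h | h | h
    · exact hkey j x y h
    · exact absurd h hxy
    · exact (hkey j y x h).symm
  · intro x ε hε
    obtain ⟨n, hn⟩ := exists_nat_one_div_lt (show (0 : ℝ) < ε / 2 by linarith)
    have hwf : WellFounded (WellOrderingRel (α := X)) := IsWellFounded.wf
    have hne : {c : X | dist x c < r n}.Nonempty := ⟨x, by simpa using hr n⟩
    obtain ⟨c, hc, hmin⟩ := hwf.has_min _ hne
    have hc' : dist x c < r n := hc
    obtain ⟨l, hl⟩ := exists_nat_one_div_lt (show (0 : ℝ) < r n - dist x c by linarith)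
    refine ⟨(n, l), subset_closure (Set.mem_iUnion.2 ⟨c, hc', ?_, ?_⟩), ?_⟩
    · intro x' hx'
      by_contra hlt
      push Not at hlt
      exact hmin x' hlt hx'
    · intro z hz
      have hz' : dist z x < 1 / ((l : ℝ) + 1) := hz
      have := dist_triangle z x c
      change dist z c < r n
      linarith
    · intro y u hu v hv
      have h1 : dist u y < r n := hWb _ _ _ hu
      have h2 : dist v y < r n := hWb _ _ _ hv
      have h3 : r n < ε / 2 := hn
      have := dist_triangle_right u v y
      linarith

/-! ### Avoidable sets from a base -/

lemma frontier_piece {X : Type} [TopologicalSpace X] (N : Set X) (W : X → Set X) (hN : IsOpen N)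
    (hW : ∀ x, IsOpen (W x)) (hd : ∀ x y, x ≠ y → Disjoint (W x) (W y))
    (hc : closure N ⊆ ⋃ x, W x) (C : Set X) {u : X}
    (hu : u ∈ closure (N ∩ ⋃ x ∈ C, W x)) (hu2 : u ∉ N ∩ ⋃ x ∈ C, W x) : u ∈ frontier N := by
  have hcl : u ∈ closure N := closure_mono Set.inter_subset_left hu
  rw [hN.frontier_eq]
  refine ⟨hcl, fun huN => hu2 ⟨huN, ?_⟩⟩
  obtain ⟨x, hx⟩ := Set.mem_iUnion.1 (hc hcl)
  obtain ⟨v, hv1, hv2⟩ := mem_closure_iff.1 hu (W x) (hW x) hx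
  obtain ⟨y, hyC, hy⟩ := Set.mem_iUnion₂.1 hv2.2
  have hxy : x = y := by
    by_contra hne
    exact Set.disjoint_left.1 (hd x y hne) hv1 hy
  subst hxy
  exact Set.mem_biUnion hyC hx

lemma avoidable_of_base {X : Type} [MetricSpace X] (N : ℕ → Set X) (W : ℕ → X → Set X)
    (hN : ∀ j, IsOpen (N j)) (hW : ∀ j x, IsOpen (W j x))
    (hd : ∀ j x y, x ≠ y → Disjoint (W j x) (W j y)) (hc : ∀ j, closure (N j) ⊆ ⋃ x, W j x)
    (hsm : ∀ x : X, ∀ ε > 0, ∃ j, x ∈ N j ∧ ∀ y, ∀ u ∈ W j y, ∀ v ∈ W j y, dist u v < ε)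
    (Z : Set X) (hZ : ∀ j, ∀ z ∈ Z, z ∉ frontier (N j)) : Avoidable Z := by
  intro F O hF hO hFO
  obtain ⟨G1, hG1, hFG1, hG1O⟩ := normal_exists_closure_subset hF hO hFO
  obtain ⟨G2, hG2, hFG2, hG2O⟩ := normal_exists_closure_subset isClosed_closure hO hG1O
  -- `A1 = closure G1`, `B1 = G2ᶜ`
  set P : ℕ → Set X := fun j => N j ∩ ⋃ x ∈ {x | Disjoint (W j x) G2ᶜ}, W j x with hP
  set Q : ℕ → Set X := fun j => N j ∩ ⋃ x ∈ {x | Disjoint (W j x) (closure G1)}, W j x with hQ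
  have hPo : ∀ j, IsOpen (P j) := fun j => (hN j).inter (isOpen_biUnion fun x _ => hW j x)
  have hQo : ∀ j, IsOpen (Q j) := fun j => (hN j).inter (isOpen_biUnion fun x _ => hW j x)
  have hPz : ∀ j, ∀ z ∈ Z, z ∉ P j → z ∉ closure (P j) := fun j z hz h1 h2 =>
    hZ j z hz (frontier_piece (N j) (W j) (hN j) (hW j) (hd j) (hc j) _ h2 h1)
  have hQz : ∀ j, ∀ z ∈ Z, z ∉ Q j → z ∉ closure (Q j) := fun j z hz h1 h2 =>
    hZ j z hz (frontier_piece (N j) (W j) (hN j) (hW j) (hd j) (hc j) _ h2 h1)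
  have hPG : ∀ j, P j ⊆ G2 := by
    rintro j u ⟨_, hu⟩
    obtain ⟨y, hyC, hy⟩ := Set.mem_iUnion₂.1 hu
    by_contra hcon
    exact Set.disjoint_left.1 hyC hy hcon
  have hQG : ∀ j, Q j ⊆ (closure G1)ᶜ := by
    rintro j u ⟨_, hu⟩
    obtain ⟨y, hyC, hy⟩ := Set.mem_iUnion₂.1 hu
    exact fun hcon => Set.disjoint_left.1 hyC hy hcon
  have hPcl : ∀ j, closure (P j) ⊆ O := fun j => (closure_mono (hPG j)).trans hG2O
  have hQcl : ∀ j, ∀ x ∈ F, x ∉ closure (Q j) := by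
    intro j x hx hcl
    obtain ⟨v, hv1, hv2⟩ := mem_closure_iff.1 hcl G1 hG1 (hFG1 hx)
    exact hQG j hv2 (subset_closure hv1)
  have hcov : ∀ x, ∃ j, x ∈ P j ∨ x ∈ Q j := by
    intro x
    by_cases hx : x ∈ closure G1
    · obtain ⟨ε, hε, hb⟩ := Metric.isOpen_iff.1 hG2 x (hFG2 hx)
      obtain ⟨j, hj, hs⟩ := hsm x ε hε
      obtain ⟨y, hy⟩ := Set.mem_iUnion.1 (hc j (subset_closure hj))
      refine ⟨j, Or.inl ⟨hj, Set.mem_biUnion (x := y) ?_ hy⟩⟩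
      exact Set.disjoint_left.2 fun u hu hu2 => hu2 (hb (hs y u hu x hy))
    · obtain ⟨ε, hε, hb⟩ := Metric.isOpen_iff.1 isClosed_closure.isOpen_compl x hx
      obtain ⟨j, hj, hs⟩ := hsm x ε hε
      obtain ⟨y, hy⟩ := Set.mem_iUnion.1 (hc j (subset_closure hj))
      refine ⟨j, Or.inr ⟨hj, Set.mem_biUnion (x := y) ?_ hy⟩⟩
      exact Set.disjoint_left.2 fun u hu hu2 => hb (hs y u hu x hy) hu2
  set U : Set X := ⋃ j, (P j \ ⋃ i ∈ Set.Iio j, closure (Q i)) with hU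
  set V : Set X := ⋃ j, (Q j \ ⋃ i ∈ Set.Iic j, closure (P i)) with hV
  have hUo : IsOpen U := isOpen_iUnion fun j =>
    (hPo j).sdiff ((Set.finite_Iio j).isClosed_biUnion fun _ _ => isClosed_closure)
  have hVo : IsOpen V := isOpen_iUnion fun j =>
    (hQo j).sdiff ((Set.finite_Iic j).isClosed_biUnion fun _ _ => isClosed_closure)
  have hUV : Disjoint U V := by
    rw [Set.disjoint_left]
    intro u hu hv
    obtain ⟨j, hj1, hj2⟩ := Set.mem_iUnion.1 hu
    obtain ⟨i, hi1, hi2⟩ := Set.mem_iUnion.1 hv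
    rcases lt_or_ge i j with hij | hij
    · exact hj2 (Set.mem_biUnion (x := i) hij (subset_closure hi1))
    · exact hi2 (Set.mem_biUnion (x := j) hij (subset_closure hj1))
  have hclU : ∀ x ∈ closure U, x ∉ V := by
    intro x hx hxV
    obtain ⟨v, hv1, hv2⟩ := mem_closure_iff.1 hx V hVo hxV
    exact Set.disjoint_left.1 hUV hv2 hv1
  refine ⟨U, hUo, ?_, ?_, ?_⟩
  · intro x hx
    obtain ⟨j, hj | hj⟩ := hcov x
    · refine Set.mem_iUnion.2 ⟨j, hj, fun h => ?_⟩
      obtain ⟨i, _, hi⟩ := Set.mem_iUnion₂.1 h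
      exact hQcl i x hx hi
    · exact absurd (subset_closure hj) (hQcl j x hx)
  · intro x hx
    by_contra hxO
    obtain ⟨j, hj | hj⟩ := hcov x
    · exact hxO (hPcl j (subset_closure hj))
    · refine hclU x hx (Set.mem_iUnion.2 ⟨j, hj, fun h => ?_⟩)
      obtain ⟨i, _, hi⟩ := Set.mem_iUnion₂.1 h
      exact hxO (hPcl i hi)
  · rw [Set.disjoint_left]
    intro z hz hzZ
    rw [hUo.frontier_eq] at hz
    have hfind := Nat.find_spec (hcov z)
    have hmin := fun i => Nat.find_min (hcov z) (m := i)
    set j := Nat.find (hcov z) with hj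
    by_cases hzP : z ∈ P j
    · refine hz.2 (Set.mem_iUnion.2 ⟨j, hzP, fun h => ?_⟩)
      obtain ⟨i, hij, hi⟩ := Set.mem_iUnion₂.1 h
      exact hQz i z hzZ (fun h' => hmin i hij (Or.inr h')) hi
    · refine hclU z hz.1 (Set.mem_iUnion.2 ⟨j, hfind.resolve_left hzP, fun h => ?_⟩)
      obtain ⟨i, hij, hi⟩ := Set.mem_iUnion₂.1 h
      refine hPz i z hzZ (fun h' => ?_) hi
      rcases lt_or_eq_of_le (show i ≤ j from hij) with h1 | h1
      · exact hmin i h1 (Or.inl h')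
      · rw [h1] at h'
        exact hzP h'

lemma DLE_of_covDimLE {X : Type} [MetricSpace X] {m : ℕ} (hX : CovDimLE X m) :
    DLE X (m + 1) := by
  obtain ⟨F, W, hF, hW, hd, hFW, hsm⟩ := sigmaBase X
  obtain ⟨N, hN, hFN, hNW, hfr⟩ := seqPartitions (ι := (ℕ × ℕ) × Fin (m + 1)) hX
    (fun j => F j.1) (fun j => ⋃ x, W j.1 x) (fun j => hF j.1)
    (fun j => isOpen_iUnion fun x => hW j.1 x) (fun j => hFW j.1)
  obtain ⟨e, he⟩ := exists_surjective_nat (ℕ × ℕ)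
  refine ⟨fun i => {x | ∀ j, x ∉ frontier (N (j, i))}, ?_, ?_⟩
  · intro i
    refine avoidable_of_base (fun n => N (e n, i)) (fun n => W (e n)) (fun n => hN _)
      (fun n => hW _) (fun n => hd _) (fun n => hNW (e n, i)) ?_ _ (fun n z hz => hz (e n))
    intro x ε hε
    obtain ⟨j, hj, hs⟩ := hsm x ε hε
    obtain ⟨n, rfl⟩ := he j
    exact ⟨n, hFN (e n, i) hj, hs⟩
  · rw [Set.eq_univ_iff_forall]
    intro x
    by_contra hcon
    simp only [Set.mem_iUnion, not_exists] at hcon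
    have h1 : ∀ i : Fin (m + 1), ∃ j, x ∈ frontier (N (j, i)) := by
      intro i
      by_contra h2
      push Not at h2
      exact hcon i h2
    choose f hf using h1
    obtain ⟨p, hp, hx⟩ := hfr (Finset.univ.image (fun i => (f i, i)))
      (by rw [Finset.card_image_of_injective _ (fun a b h => (Prod.ext_iff.1 h).2)]; simp) x
    obtain ⟨i, _, rfl⟩ := Finset.mem_image.1 hp
    exact hx (hf i)


-- STATEMENT 8
theorem statement8 (k n : ℕ) (hk : 2 ≤ k) (hn : 1 ≤ n) (X : Type) [MetricSpace X]
    (h : covDim X = Dim.ofOrdinal ((k * n : ℕ) : Ordinal.{0})) :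
    KInd (bComplex k) X = Dim.ofOrdinal ((n : ℕ) : Ordinal.{0}) ∧
      KStr (bComplex k) X = 0 := by
  have hinj : ∀ a b : Ordinal.{0}, Dim.ofOrdinal a = Dim.ofOrdinal b → a = b := by
    intro a b hab
    exact WithBot.coe_injective (WithTop.coe_injective hab)
  have hne : ¬ IsEmpty X := by
    intro he
    rw [covDim, if_pos he] at h
    have := WithTop.coe_injective h
    exact WithBot.bot_ne_coe this
  have hex : ∃ n, CovDimLE X n := by
    by_contra he
    rw [covDim, if_neg hne, if_neg he] at h
    exact WithTop.top_ne_coe h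
  rw [covDim, if_neg hne, if_pos hex] at h
  have hs : sInf {n | CovDimLE X n} = k * n := by
    exact_mod_cast hinj _ _ h
  have hup : CovDimLE X (k * n) := by
    rw [← hs]
    exact Nat.sInf_mem hex
  have hkn : 1 ≤ k * n := Nat.mul_pos (by omega) hn
  have hlow : ¬ CovDimLE X (k * n - 1) := by
    intro h1
    have := Nat.sInf_le (s := {n | CovDimLE X n}) h1
    omega
  obtain ⟨p, rfl⟩ : ∃ p, n = p + 1 := ⟨n - 1, by omega⟩
  have hD := DLE_of_covDimLE hup
  have hlt : (p : Ordinal.{0}) < ((p + 1 : ℕ) : Ordinal.{0}) := by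
    exact_mod_cast Nat.lt_succ_self p
  have hle : KIndLE (bComplex k) X ((p + 1 : ℕ) : Ordinal.{0}) := by
    rw [kIndLE_iff]
    intro F hF hK
    obtain ⟨U, ⟨h1, h2, h3⟩, _, h4⟩ := exists_nbhd_noObs hk hD F hF ((isKTuple_bComplex F).1 hK)
    exact ⟨U, h1, h2, h3, Or.inr ⟨_, hlt, h4⟩⟩
  have hinf : sInf {α | KIndLE (bComplex k) X α} = ((p + 1 : ℕ) : Ordinal.{0}) := by
    apply le_antisymm (csInf_le' (s := {α | KIndLE (bComplex k) X α}) hle)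
    refine le_csInf ⟨_, hle⟩ fun β hβ => ?_
    by_contra hcon
    push Not at hcon
    obtain ⟨q, rfl⟩ := Ordinal.lt_omega0.1 (hcon.trans (Ordinal.natCast_lt_omega0 _))
    have hq : q < p + 1 := by exact_mod_cast hcon
    refine hlow (kIndLE_covDim hβ _ ?_)
    have := Nat.mul_le_mul_left k (show q + 1 ≤ p + 1 by omega)
    omega
  have hKI : KInd (bComplex k) X = Dim.ofOrdinal ((p + 1 : ℕ) : Ordinal.{0}) := by
    rw [KInd, if_neg hne, if_pos ⟨_, hle⟩, hinf]
  refine ⟨hKI, ?_⟩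
  rw [KStr, if_neg]
  rintro ⟨_, F, hF, hK, hU⟩
  obtain ⟨U, h1, h2, h4⟩ := exists_nbhd_noObs hk hD F hF ((isKTuple_bComplex F).1 hK)
  refine hU U h1 ?_ h2
  rw [hKI, KInd]
  split_ifs with he hx
  · exact WithTop.coe_lt_coe.2 (WithBot.bot_lt_coe _)
  · exact WithTop.coe_lt_coe.2 (WithBot.coe_lt_coe.2 ((csInf_le'
      (s := {α | KIndLE (bComplex k) (↥((⋃ i, U i)ᶜ)) α}) h4).trans_lt hlt))
  · exact absurd ⟨_, h4⟩ hx

end
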